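/- arXiv:2105.02736 — 3 statements merged into one kernel-verified Lean document; each statement's English description precedes it below -/
import Mathlib

section
/- For every linear forest H (a disjoint union of paths), a graph G contains H as an induced subgraph if and only if its blob graph Blob(G) contains H as an induced subgraph. -/
/-- The blob graph of `G`. -/
def Blob {V : Type*} (G : SimpleGraph V) :
    SimpleGraph {X : Set V // X.Nonempty ∧ (G.induce X).Connected} :=
  SimpleGraph.fromRel (fun A B =>
    ((A : Set V) ∩ (B : Set V)).Nonempty ∨
      ∃ x ∈ (A : Set V), ∃ y ∈ (B : Set V), G.Adj x y)

/-- A linear forest: every connected component is a path. -/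
def IsLinearForest {W : Type*} (H : SimpleGraph W) : Prop :=
  ∀ c : H.ConnectedComponent, ∃ r : ℕ,
    Nonempty ((H.induce c.supp) ≃g SimpleGraph.pathGraph r)

theorem Blob.adj_iff {V : Type*} {G : SimpleGraph V}
    {A B : {X : Set V // X.Nonempty ∧ (G.induce X).Connected}} :
    (Blob G).Adj A B ↔ A ≠ B ∧ ((A.1 ∩ B.1).Nonempty ∨ ∃ x ∈ A.1, ∃ y ∈ B.1, G.Adj x y) := by
  simp only [Blob, SimpleGraph.fromRel_adj]
  refine and_congr_right fun _ => ⟨?_, Or.inl⟩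
  rintro (h | h | ⟨x, hx, y, hy, h⟩)
  · exact h
  · exact Or.inl (Set.inter_comm _ _ ▸ h)
  · exact Or.inr ⟨y, hy, x, hx, h.symm⟩

/-- A graph embeds in its blob graph via singletons. -/
def Blob.singletonEmbedding {V : Type*} (G : SimpleGraph V) : G ↪g Blob G where
  toFun v := ⟨{v}, Set.singleton_nonempty v, by
    have : Subsingleton ({v} : Set V) := by simp
    exact SimpleGraph.Connected.mk SimpleGraph.Preconnected.of_subsingleton⟩
  inj' u v h := by simpa using congrArg Subtype.val h
  map_rel_iff' {u v} := by
    rw [Blob.adj_iff]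
    constructor
    · rintro ⟨hne, ⟨x, rfl, rfl⟩ | ⟨x, rfl, y, rfl, h⟩⟩
      · exact absurd rfl hne
      · exact h
    · intro h
      exact ⟨fun e => h.ne (Set.singleton_injective (congrArg Subtype.val e)),
        Or.inr ⟨u, rfl, v, rfl, h⟩⟩

/-- The initial part of a geodesic is an induced path. -/
theorem SimpleGraph.Reachable.exists_pathGraph_embedding {V : Type*} {G : SimpleGraph V} {a b : V}
    (h : G.Reachable a b) {n : ℕ} (hn : n ≤ G.dist a b) :
    Nonempty (SimpleGraph.pathGraph (n + 1) ↪g G) := by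
  obtain ⟨p, hp⟩ := h.exists_walk_length_eq_dist
  have hd : ∀ i ≤ p.length, G.dist a (p.getVert i) = i := by
    intro i hi
    have h₁ := SimpleGraph.dist_le (p.take i)
    have h₂ := SimpleGraph.dist_le (p.drop i)
    have h₃ := (p.take i).reachable.dist_triangle_left b
    simp only [SimpleGraph.Walk.take_length, SimpleGraph.Walk.drop_length] at h₁ h₂
    omega
  have hd' : ∀ i : Fin (n + 1), G.dist a (p.getVert i) = i := fun i => hd i (by omega)
  refine ⟨⟨⟨fun i => p.getVert i, fun i j hij => ?_⟩, fun {i j} => ?_⟩⟩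
  · have := congrArg (G.dist a) hij
    simp only [hd'] at this
    exact Fin.ext this
  · change G.Adj (p.getVert i) (p.getVert j) ↔ _
    rw [SimpleGraph.pathGraph_adj]
    constructor
    · intro hadj
      have hne : (i : ℕ) ≠ j := fun e => hadj.ne (by rw [e])
      have h₁ := (p.take i).reachable.dist_triangle_left (p.getVert j)
      have h₂ := (p.take j).reachable.dist_triangle_left (p.getVert i)
      rw [hd', hd', SimpleGraph.dist_eq_one_iff_adj.mpr hadj] at h₁
      rw [hd', hd', SimpleGraph.dist_eq_one_iff_adj.mpr hadj.symm] at h₂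
      omega
    · rintro (e | e)
      · rw [← e]
        exact p.adj_getVert_succ (by omega)
      · rw [← e]
        exact (p.adj_getVert_succ (by omega)).symm

/-- An induced path of blobs contains in its union an induced path of vertices of the same order. -/
theorem Blob.exists_pathGraph_embedding {V : Type*} {G : SimpleGraph V} {n : ℕ}
    (φ : SimpleGraph.pathGraph (n + 1) ↪g Blob G) :
    ∃ g : SimpleGraph.pathGraph (n + 1) ↪g G, ∀ i, ∃ j, g i ∈ (φ j).1 := by
  set U : Set V := ⋃ j, (φ j).1
  have hsub : ∀ j, (φ j).1 ⊆ U := fun j => Set.subset_iUnion (fun j => (φ j).1) j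
  suffices Nonempty (SimpleGraph.pathGraph (n + 1) ↪g G.induce U) by
    obtain ⟨g⟩ := this
    exact ⟨(SimpleGraph.Embedding.induce U).comp g, fun i => Set.mem_iUnion.mp (g i).2⟩
  have hreach : ∀ j, ∀ x y : U, x.1 ∈ (φ j).1 → y.1 ∈ (φ j).1 → (G.induce U).Reachable x y :=
    fun j x y hx hy => ((φ j).2.2.preconnected ⟨x, hx⟩ ⟨y, hy⟩).map
      (SimpleGraph.induceHomOfLE G (hsub j)).toHom
  -- Blobs containing adjacent vertices have consecutive or equal indices.
  have hstep : ∀ i j, ∀ x ∈ (φ i).1, ∀ y ∈ (φ j).1, G.Adj x y → (j : ℕ) ≤ i + 1 := by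
    intro i j x hx y hy hxy
    by_cases hij : i = j
    · subst hij; omega
    · have : (Blob G).Adj (φ i) (φ j) :=
        Blob.adj_iff.mpr ⟨fun e => hij (φ.injective e), Or.inr ⟨x, hx, y, hy, hxy⟩⟩
      rw [φ.map_adj_iff, SimpleGraph.pathGraph_adj] at this
      omega
  have hconn : ∀ (k : ℕ) (hk : k < n + 1) (x y : U), x.1 ∈ (φ 0).1 → y.1 ∈ (φ ⟨k, hk⟩).1 →
      (G.induce U).Reachable x y := by
    intro k
    induction k with
    | zero => exact fun hk x y hx hy => hreach 0 x y hx hy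
    | succ k ih =>
      intro hk x y hx hy
      have hadj : (Blob G).Adj (φ ⟨k, by omega⟩) (φ ⟨k + 1, hk⟩) :=
        φ.map_adj_iff.mpr (SimpleGraph.pathGraph_adj.mpr (Or.inl rfl))
      rcases (Blob.adj_iff.mp hadj).2 with ⟨z, hz, hz'⟩ | ⟨z, hz, w, hw, hzw⟩
      · exact (ih (by omega) x ⟨z, hsub _ hz⟩ hx hz).trans (hreach _ ⟨z, hsub _ hz⟩ y hz' hy)
      · have : (G.induce U).Adj ⟨z, hsub _ hz⟩ ⟨w, hsub _ hw⟩ := hzw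
        exact ((ih (by omega) x ⟨z, hsub _ hz⟩ hx hz).trans this.reachable).trans
          (hreach _ ⟨w, hsub _ hw⟩ y hw hy)
  have hwalk : ∀ (x y : U) (p : (G.induce U).Walk x y) (i j : Fin (n + 1)), x.1 ∈ (φ i).1 →
      y.1 ∈ (φ j).1 → x ≠ y → (j : ℕ) ≤ i + p.length := by
    intro x y p
    induction p with
    | nil => exact fun _ _ _ _ h => absurd rfl h
    | @cons u v w huv p ih =>
      intro i j hx hy _
      rw [SimpleGraph.Walk.length_cons]
      by_cases hvw : v = w
      · have := hstep i j u hx v (hvw ▸ hy) huv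
        omega
      · obtain ⟨l, hl⟩ := Set.mem_iUnion.mp v.2
        have h₁ := hstep i l u hx v hl huv
        have h₂ := ih l j hl hy hvw
        omega
  obtain ⟨a, ha, b, hb, hab⟩ : ∃ a ∈ (φ 0).1, ∃ b ∈ (φ (Fin.last n)).1, n ≠ 0 → a ≠ b := by
    by_contra! hcon
    obtain ⟨a₀, ha₀⟩ := (φ 0).2.1
    obtain ⟨b₀, hb₀⟩ := (φ (Fin.last n)).2.1
    have hn : n ≠ 0 := (hcon a₀ ha₀ b₀ hb₀).1
    have heq : φ 0 = φ (Fin.last n) := by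
      apply Subtype.ext
      ext x
      constructor
      · intro hx
        rw [(hcon x hx b₀ hb₀).2]
        exact hb₀
      · intro hx
        rw [← (hcon a₀ ha₀ x hx).2]
        exact ha₀
    have := congrArg Fin.val (φ.injective heq)
    simp at this
    omega
  have hr : (G.induce U).Reachable ⟨a, hsub _ ha⟩ ⟨b, hsub _ hb⟩ :=
    hconn n (by omega) _ _ ha hb
  refine hr.exists_pathGraph_embedding ?_
  obtain ⟨p, hp⟩ := hr.exists_walk_length_eq_dist
  rw [← hp]
  by_cases hn : n = 0
  · omega
  · have := hwalk _ _ p 0 (Fin.last n) ha hb (fun e => hab hn (congrArg Subtype.val e))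
    simpa using this

/-- For every linear forest `H`, a graph `G` contains `H` as an induced subgraph
iff its blob graph does. -/
theorem induced_linear_forest_iff_blob {V W : Type*} [Fintype V] [Fintype W]
    (G : SimpleGraph V) (H : SimpleGraph W) (hH : IsLinearForest H) :
    Nonempty (H ↪g G) ↔ Nonempty (H ↪g Blob G) := by
  refine ⟨fun ⟨g⟩ => ⟨(Blob.singletonEmbedding G).comp g⟩, fun ⟨f⟩ => ?_⟩
  have hcomp : ∀ c : H.ConnectedComponent, ∃ g : H.induce c.supp ↪g G,
      ∀ w, ∃ w' ∈ c.supp, g w ∈ (f w').1 := by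
    intro c
    obtain ⟨r, ⟨e⟩⟩ := hH c
    obtain ⟨w₀, hw₀⟩ := c.nonempty_supp
    obtain ⟨n, rfl⟩ : ∃ n, r = n + 1 :=
      Nat.exists_eq_succ_of_ne_zero (by rintro rfl; exact (e ⟨w₀, hw₀⟩).elim0)
    obtain ⟨g, hg⟩ := Blob.exists_pathGraph_embedding
      ((f.comp (SimpleGraph.Embedding.induce c.supp)).comp e.symm.toEmbedding)
    refine ⟨g.comp e.toEmbedding, fun w => ?_⟩
    obtain ⟨j, hj⟩ := hg (e w)
    exact ⟨e.symm j, (e.symm j).2, hj⟩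
  choose g hg using hcomp
  -- Vertices chosen in different components are distinct and nonadjacent.
  have hsep : ∀ c d (u : c.supp) (v : d.supp),
      (g c u = g d v ∨ G.Adj (g c u) (g d v)) → c = d := by
    intro c d u v h
    obtain ⟨u', hu', hu⟩ := hg c u
    obtain ⟨v', hv', hv⟩ := hg d v
    rw [SimpleGraph.ConnectedComponent.mem_supp_iff] at hu' hv'
    rw [← hu', ← hv']
    by_cases huv : u' = v'
    · rw [huv]
    have hadj : (Blob G).Adj (f u') (f v') := by
      refine Blob.adj_iff.mpr ⟨fun e => huv (f.injective e), h.imp (fun e => ?_) fun e => ?_⟩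
      · exact ⟨_, hu, e ▸ hv⟩
      · exact ⟨_, hu, _, hv, e⟩
    exact SimpleGraph.ConnectedComponent.sound (f.map_adj_iff.mp hadj).reachable
  have hsame : ∀ c d (u : c.supp) (v : d.supp), c = d →
      (g c u = g d v → u.1 = v.1) ∧ (G.Adj (g c u) (g d v) ↔ H.Adj u v) := by
    rintro c _ u v rfl
    exact ⟨fun e => congrArg Subtype.val ((g c).injective e), (g c).map_adj_iff⟩
  let F : W → V := fun w => g (H.connectedComponentMk w) ⟨w, rfl⟩
  refine ⟨⟨⟨F, fun u v h => ?_⟩, fun {u v} => ⟨fun h => ?_, fun h => ?_⟩⟩⟩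
  · exact (hsame _ _ _ _ (hsep _ _ _ _ (Or.inl h))).1 h
  · exact (hsame _ _ _ _ (hsep _ _ _ _ (Or.inr h))).2.mp h
  · exact (hsame _ _ _ _ (SimpleGraph.ConnectedComponent.sound h.reachable)).2.mpr h
end

section
/- A graph contains no even cycle as a subgraph if and only if every block of it is either an edge (K₂) or an odd cycle (i.e., the graph is an odd cactus). -/
/-- `B` induces a biconnected subgraph of `G`: at least two vertices, connected,
and removing any vertex keeps it connected. -/
def IsBiconnectedSet {V : Type*} (G : SimpleGraph V) (B : Set V) : Prop :=
  2 ≤ B.ncard ∧ (G.induce B).Connected ∧ ∀ v ∈ B, (G.induce (B \ {v})).Preconnected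

/-- A block of `G`: a maximal biconnected subgraph. -/
def IsBlock {V : Type*} (G : SimpleGraph V) (B : Set V) : Prop :=
  IsBiconnectedSet G B ∧ ∀ B', IsBiconnectedSet G B' → B ⊆ B' → B = B'

namespace SimpleGraph

variable {V : Type*} {G : SimpleGraph V}

namespace Walk

/-- The concatenation of two paths from `x` to `y` (one of them reversed) that only share their
distinct ends is a cycle, unless both paths are single edges. -/
theorem IsPath.isCycle_append_reverse {x y : V} {p q : G.Walk x y} (hp : p.IsPath) (hq : q.IsPath)
    (hpq : ∀ z ∈ p.support, z ∈ q.support → z = x ∨ z = y)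
    (hl : 1 < p.length ∨ 1 < q.length) : (p.append q.reverse).IsCycle := by
  refine hp.isCycle_append hq.reverse ?_ (by simpa using hl)
  intro z hzp hzq
  have hx : x ∉ p.support.tail := by
    have := hp.support_nodup
    rw [← cons_tail_support] at this
    exact (List.nodup_cons.1 this).1
  have hy : y ∉ q.reverse.support.tail := by
    have := hq.reverse.support_nodup
    rw [← cons_tail_support] at this
    exact (List.nodup_cons.1 this).1
  have hzq' : z ∈ q.support := by simpa using List.mem_of_mem_tail hzq
  rcases hpq z (List.mem_of_mem_tail hzp) hzq' with rfl | rfl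
  exacts [hx hzp, hy hzq]

/-- A cycle together with an ear (a path meeting it exactly in its two distinct ends, and which is
not an edge of the cycle) contains an even cycle. -/
theorem IsCycle.exists_even_of_ear {x y : V} {c : G.Walk x x} (hc : c.IsCycle)
    (hy : y ∈ c.support) (hxy : x ≠ y) {p : G.Walk x y} (hp : p.IsPath)
    (hpc : ∀ z ∈ p.support, z ∈ c.support → z = x ∨ z = y)
    (hl : s(x, y) ∉ c.edges ∨ p.length ≠ 1) :
    ∃ (v : V) (w : G.Walk v v), w.IsCycle ∧ Even w.length := by
  obtain ⟨a, b, rfl⟩ := mem_support_iff_exists_append.1 hy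
  have ha := hc.isPath_of_append_left (not_nil_of_ne hxy.symm)
  have hb := (hc.isPath_of_append_right (not_nil_of_ne hxy)).reverse
  have pos {q : G.Walk x y} : 1 ≤ q.length := by
    have := not_nil_iff_lt_length.1 (not_nil_of_ne hxy (p := q))
    lia
  have long {q : G.Walk x y} (hq : q.edges ⊆ (a.append b).edges) :
      1 < p.length ∨ 1 < q.length := by
    by_contra! h
    have hp1 : p.length = 1 := le_antisymm h.1 pos
    have hq1 : q.length = 1 := le_antisymm h.2 pos
    refine hl.elim (fun hl ↦ hl (hq ?_)) (fun hl ↦ hl hp1)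
    cases q with
    | nil => simp at hq1
    | cons h q =>
      cases q with
      | nil => simp
      | cons => simp at hq1
  have hca := hp.isCycle_append_reverse ha
    (fun z hz hz' ↦ hpc z hz (by simp [mem_support_append_iff, hz'])) (long (by simp))
  have hcb := hp.isCycle_append_reverse hb
    (fun z hz hz' ↦ hpc z hz (by simp_all [mem_support_append_iff]))
    (long (by intro e; simp +contextual))
  by_contra! h
  have h1 := h _ _ hc
  have h2 := h _ _ hca
  have h3 := h _ _ hcb
  simp only [length_append, length_reverse, Nat.not_even_iff_odd] at h1 h2 h3
  grind

/-- In a graph without even cycles, all cycles are chordless. -/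
theorem IsCycle.isChordless_of_not_even
    (hG : ¬ ∃ (v : V) (w : G.Walk v v), w.IsCycle ∧ Even w.length) {u : V} {c : G.Walk u u}
    (hc : c.IsCycle) : c.IsChordless := by
  classical
  rw [isChordless_iff_forall_mem_edges]
  intro x y hx hy hadj
  by_contra he
  refine hG ((hc.rotate hx).exists_even_of_ear (y := y) (by simpa using hy) hadj.ne
    hadj.isPath_toWalk (by simp) (.inl ?_))
  rwa [(c.rotate_edges x hx).perm.mem_iff]

/-- In a connected graph without even cycles and without cut vertices, every cycle is spanning. -/
theorem IsCycle.mem_support_of_not_even (hconn : G.Preconnected)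
    (hcut : ∀ v a b, a ≠ v → b ≠ v → ∃ p : G.Walk a b, v ∉ p.support)
    (hG : ¬ ∃ (v : V) (w : G.Walk v v), w.IsCycle ∧ Even w.length) {u : V} {c : G.Walk u u}
    (hc : c.IsCycle) (t : V) : t ∈ c.support := by
  classical
  by_contra ht
  obtain ⟨q⟩ := hconn u t
  obtain ⟨⟨⟨x, s⟩, hxs⟩, -, hx, hs⟩ :=
    q.exists_boundary_dart {z | z ∈ c.support} c.start_mem_support ht
  simp only [Set.mem_ofPred_eq] at hx hs hxs
  wlog hux : u = x generalizing u
  · exact this (hc.rotate hx) (by simpa using ht) (hconn _ _).some (by simp) (by simpa using hs)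
      rfl
  subst hux
  obtain ⟨q, hq⟩ := hcut u s c.snd hxs.ne' (c.adj_snd hc.not_nil).ne'
  obtain ⟨y, hy, hyq, hfirst⟩ := q.exists_mem_support_forall_mem_support_imp_eq c.support.toFinset
    ⟨c.snd, by simp⟩
  have huq : u ∉ (q.takeUntil y hyq).support :=
    fun h ↦ hq (q.support_takeUntil_subset_support hyq h)
  have huy : u ≠ y := by
    rintro rfl
    exact hq hyq
  have hsy : s ≠ y := by
    rintro rfl
    simp_all
  let p := (q.takeUntil y hyq).bypass
  have hps : p.support ⊆ (q.takeUntil y hyq).support := support_bypass_subset_support _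
  have hp0 := not_nil_iff_lt_length.1 (not_nil_of_ne hsy (p := p))
  refine hG (hc.exists_even_of_ear (by simpa using hy) huy
    (p := cons hxs p) ((bypass_isPath _).cons fun h ↦ huq (hps h)) ?_ (.inr ?_))
  · intro z hz hzc
    rw [support_cons, List.mem_cons] at hz
    exact hz.imp_right fun hz ↦ hfirst z (by simpa using hzc) (hps hz)
  · rw [length_cons]
    lia

/-- A graph with a chordless spanning cycle is a cycle graph. -/
theorem IsCycle.nonempty_iso_cycleGraph {u : V} {c : G.Walk u u}
    (hc : c.IsCycle) (hch : c.IsChordless) (hspan : ∀ t, t ∈ c.support) :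
    Nonempty (G ≃g cycleGraph c.length) := by
  classical
  obtain ⟨f⟩ := (cycleGraph_isContained_iff (G := G)
    (hc.three_le_length : 2 < c.length)).2 ⟨u, c, hc, rfl⟩
  have : Fintype V := ⟨c.support.toFinset, by simpa using hspan⟩
  have hcard : Fintype.card V = c.length := by
    have h1 : (Finset.univ : Finset V) = c.support.tail.toFinset := by
      ext t
      have := hspan t
      rw [← cons_tail_support, List.mem_cons] at this
      simp only [Finset.mem_univ, List.mem_toFinset, true_iff]
      rcases this with rfl | h
      · exact c.end_mem_tail_support hc.not_nil
      · exact h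
    rw [← Finset.card_univ, h1, List.toFinset_card_of_nodup hc.support_nodup]
    simp
  have hbij : Function.Bijective f :=
    (Fintype.bijective_iff_injective_and_card f).2 ⟨f.injective, by simp [hcard]⟩
  refine ⟨(RelIso.mk (Equiv.ofBijective f hbij) ?_).symm⟩
  intro i j
  refine ⟨fun hij ↦ ?_, fun hij ↦ f.toHom.map_adj hij⟩
  have hsub : f '' (cycleGraph c.length).neighborSet i ⊆ c.toSubgraph.neighborSet (f i) := by
    rintro _ ⟨k, hk, rfl⟩
    exact adj_toSubgraph_iff_mem_edges.2 (hch.mem_edges (hspan _) (hspan _) (f.toHom.map_adj hk))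
  have heq := Set.eq_of_subset_of_ncard_le hsub (by
    rw [hc.ncard_neighborSet_toSubgraph_eq_two (hspan _),
      Set.ncard_image_of_injective _ hbij.1]
    have := hc.three_le_length
    generalize c.length = n at *
    obtain ⟨n, rfl⟩ := Nat.exists_eq_add_of_le' this
    rw [Set.ncard_eq_toFinset_card', ← neighborFinset_def, card_neighborFinset_eq_degree,
      cycleGraph_degree_three_le])
  have hj : f j ∈ c.toSubgraph.neighborSet (f i) :=
    adj_toSubgraph_iff_mem_edges.2 (hch.mem_edges (hspan _) (hspan _) hij)
  rw [← heq] at hj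
  obtain ⟨k, hk, hkj⟩ := hj
  rwa [← f.injective hkj]

/-- Every cycle of a cycle graph is spanning. -/
theorem IsCycle.length_eq_of_cycleGraph {n : ℕ} {u : Fin n} {c : (cycleGraph n).Walk u u}
    (hc : c.IsCycle) : c.length = n := by
  classical
  have hn : c.length ≤ n := by
    have := hc.isPath_tail.length_lt
    have := length_tail_add_one hc.not_nil
    simp_all
    lia
  obtain ⟨n, rfl⟩ := Nat.exists_eq_add_of_le' (hc.three_le_length.trans hn)
  have hmem (t) : t ∈ c.support := by
    by_contra ht
    obtain ⟨q⟩ := cycleGraph_preconnected u t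
    obtain ⟨⟨⟨x, s⟩, hxs⟩, -, hx, hs⟩ :=
      q.exists_boundary_dart {z | z ∈ c.support} c.start_mem_support ht
    simp only [Set.mem_ofPred_eq] at hx hs hxs
    have heq := Set.eq_of_subset_of_ncard_le (c.toSubgraph.neighborSet_subset x) (by
      rw [hc.ncard_neighborSet_toSubgraph_eq_two hx, Set.ncard_eq_toFinset_card',
        ← neighborFinset_def, card_neighborFinset_eq_degree, cycleGraph_degree_three_le])
    have : s ∈ c.toSubgraph.neighborSet x := by
      rw [heq]
      exact hxs
    exact hs (c.mem_verts_toSubgraph.1 (Subgraph.Adj.symm this).fst_mem)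
  have : Finset.univ ⊆ c.tail.support.toFinset := by
    intro t _
    have := hmem t
    rw [support_tail_of_not_nil _ hc.not_nil, List.mem_toFinset]
    rw [← cons_tail_support, List.mem_cons] at this
    rcases this with rfl | h
    · exact c.end_mem_tail_support hc.not_nil
    · exact h
  have := (Finset.card_le_card this).trans (List.toFinset_card_le _)
  have := length_tail_add_one hc.not_nil
  simp_all
  lia

/-- The support of a cycle induces a biconnected subgraph. -/
theorem IsCycle.isBiconnectedSet_support {u : V} {c : G.Walk u u} (hc : c.IsCycle) :
    IsBiconnectedSet G {z | z ∈ c.support} := by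
  classical
  refine ⟨?_, c.connected_induce_support, ?_⟩
  · have hfin : {z | z ∈ c.support}.Finite := c.support.finite_toSet
    have : ({u, c.snd} : Set V) ⊆ {z | z ∈ c.support} := by
      rintro z (rfl | rfl) <;> simp
    rw [← Set.ncard_pair (c.adj_snd hc.not_nil).ne]
    exact Set.ncard_le_ncard this hfin
  · intro v hv
    have hr := hc.rotate hv
    have heq : {z | z ∈ c.support} \ {v} = {z | z ∈ (c.rotate v hv).tail.dropLast.support} := by
      have hp := hr.isPath_tail.support_nodup
      have hnil : ¬ (c.rotate v hv).tail.Nil := by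
        rw [not_nil_iff_lt_length]
        have := length_tail_add_one hr.not_nil
        have := hr.three_le_length
        lia
      ext z
      have h1 : z ∈ c.support ↔ z ∈ (c.rotate v hv).support := by simp
      simp only [Set.mem_sdiff, Set.mem_ofPred_eq, Set.mem_singleton_iff, h1]
      rw [← support_dropLast_concat hnil] at hp
      rw [← cons_tail_support, ← support_tail_of_not_nil _ hr.not_nil,
        ← support_dropLast_concat hnil]
      grind
    rw [heq]
    exact (connected_induce_support _).preconnected

end Walk

/-- A connected graph on at least three vertices without cut vertices contains a cycle. -/
theorem Connected.exists_isCycle_of_three_le_card [Finite V] (hconn : G.Connected)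
    (hcut : ∀ v a b, a ≠ v → b ≠ v → ∃ p : G.Walk a b, v ∉ p.support)
    (hcard : 3 ≤ Nat.card V) : ∃ (v : V) (c : G.Walk v v), c.IsCycle := by
  classical
  have : Nontrivial V := Finite.one_lt_card_iff_nontrivial.1 (by lia)
  obtain ⟨a⟩ := hconn.nonempty
  obtain ⟨b, hab⟩ := hconn.preconnected.exists_adj_of_nontrivial a
  obtain ⟨t, ht⟩ : ∃ t, t ∉ ({a, b} : Set V) := by
    by_contra! h
    have := Set.ncard_univ V
    rw [← Set.eq_univ_of_forall h, Set.ncard_pair hab.ne] at this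
    lia
  obtain ⟨q⟩ := hconn.preconnected a t
  obtain ⟨⟨⟨x, s⟩, hxs⟩, -, hx, hs⟩ := q.exists_boundary_dart {a, b} (by simp) ht
  obtain ⟨o, hxo, hso⟩ : ∃ o, G.Adj x o ∧ s ≠ o := by
    rcases hx with rfl | rfl
    exacts [⟨b, hab, fun h ↦ hs (.inr h)⟩, ⟨a, hab.symm, fun h ↦ hs (.inl h)⟩]
  obtain ⟨p, hp⟩ := hcut x s o hxs.ne' hxo.ne'
  have hpos := Walk.not_nil_iff_lt_length.1 (Walk.not_nil_of_ne hso (p := p.bypass))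
  refine ⟨x, _, hxo.isPath_toWalk.isCycle_append_reverse (q := .cons hxs p.bypass)
    (p.bypass_isPath.cons fun h ↦ hp (p.support_bypass_subset_support h)) (by simp) (.inr ?_)⟩
  rw [Walk.length_cons]
  lia

/-- A connected graph on at least three vertices without cut vertices and without even cycles is
an odd cycle. -/
theorem Connected.exists_iso_cycleGraph_of_not_even [Finite V] (hconn : G.Connected)
    (hcut : ∀ v a b, a ≠ v → b ≠ v → ∃ p : G.Walk a b, v ∉ p.support)
    (hcard : 3 ≤ Nat.card V)
    (hG : ¬ ∃ (v : V) (w : G.Walk v v), w.IsCycle ∧ Even w.length) :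
    ∃ k, 1 ≤ k ∧ Nonempty (G ≃g cycleGraph (2 * k + 1)) := by
  obtain ⟨v, c, hc⟩ := hconn.exists_isCycle_of_three_le_card hcut hcard
  have hiso := hc.nonempty_iso_cycleGraph (hc.isChordless_of_not_even hG)
    (hc.mem_support_of_not_even hconn.preconnected hcut hG)
  have hodd : Odd c.length := Nat.not_even_iff_odd.1 fun h ↦ hG ⟨v, c, hc, h⟩
  have := hc.three_le_length
  obtain ⟨k, hk⟩ := hodd
  exact ⟨k, by lia, hk ▸ hiso⟩

end SimpleGraph

open SimpleGraph

theorem IsBiconnectedSet.exists_isBlock_superset {V : Type*} [Finite V] {G : SimpleGraph V}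
    {S : Set V} (hS : IsBiconnectedSet G S) : ∃ B, IsBlock G B ∧ S ⊆ B := by
  obtain ⟨B, hSB, hB⟩ := (Set.toFinite {B | IsBiconnectedSet G B}).exists_le_maximal hS
  exact ⟨B, ⟨hB.prop, fun B' hB' h ↦ hB.eq_of_le hB' h⟩, hSB⟩

theorem IsBiconnectedSet.exists_walk_avoiding {V : Type*} {G : SimpleGraph V} {B : Set V}
    (hB : IsBiconnectedSet G B) (v a b : B) (ha : a ≠ v) (hb : b ≠ v) :
    ∃ p : (G.induce B).Walk a b, v ∉ p.support := by
  obtain ⟨p⟩ := hB.2.2 v v.2 ⟨a, a.2, by simpa [Subtype.ext_iff] using ha⟩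
    ⟨b, b.2, by simpa [Subtype.ext_iff] using hb⟩
  refine ⟨p.map (G.induceHomOfLE Set.sdiff_subset).toHom, fun h ↦ ?_⟩
  obtain ⟨z, -, hz⟩ := List.mem_map.1 ((congrArg (v ∈ ·) (Walk.support_map _ p)).mp h)
  exact z.2.2 (congrArg Subtype.val hz)

/-- A graph has no even cycle (as a subgraph) iff every block is an edge (`K₂`)
or an odd cycle, i.e. iff it is an odd cactus. -/
theorem no_even_cycle_iff_odd_cactus {V : Type*} [Fintype V] (G : SimpleGraph V) :
    (¬ ∃ (v : V) (w : G.Walk v v), w.IsCycle ∧ Even w.length) ↔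
      ∀ B : Set V, IsBlock G B →
        Nonempty ((G.induce B) ≃g (⊤ : SimpleGraph (Fin 2))) ∨
          ∃ k : ℕ, 1 ≤ k ∧ Nonempty ((G.induce B) ≃g SimpleGraph.cycleGraph (2 * k + 1)) := by
  refine ⟨fun hG B hB ↦ ?_, ?_⟩
  · obtain ⟨h2, hconn, -⟩ := hB.1
    rw [← Nat.card_coe_set_eq] at h2
    rcases h2.eq_or_lt with h2 | h3
    · left
      have e : B ≃ Fin 2 := Finite.equivFinOfCardEq h2.symm
      have htop : G.induce B = ⊤ := by
        ext a b
        refine ⟨fun h ↦ h.ne, fun hab ↦ ?_⟩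
        have : Nontrivial B := ⟨a, b, hab⟩
        obtain ⟨z, hz⟩ := hconn.preconnected.exists_adj_of_nontrivial a
        have hzb : z = b := by
          have := e.injective.ne hab
          have := e.injective.ne hz.ne
          exact e.injective (by lia)
        rwa [← hzb]
      rw [htop]
      exact ⟨Iso.completeGraph e⟩
    · right
      refine hconn.exists_iso_cycleGraph_of_not_even hB.1.exists_walk_avoiding h3 ?_
      rintro ⟨v, w, hw, heven⟩
      exact hG ⟨_, w.map (Embedding.induce B).toHom,
        (Walk.isCycle_map_iff_of_injective Subtype.val_injective).2 hw,
        (congrArg Even (w.length_map _)).mpr heven⟩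
  · rintro hB ⟨v, w, hw, heven⟩
    obtain ⟨B, hblock, hwB⟩ := hw.isBiconnectedSet_support.exists_isBlock_superset
    replace hwB : ∀ z ∈ w.support, z ∈ B := fun z hz ↦ hwB hz
    have hwi : (w.induce B hwB).IsCycle := by
      refine Walk.IsCycle.of_map (f := (Embedding.induce B).toHom) ?_
      rwa [Walk.map_induce]
    have hlen : (w.induce B hwB).length = w.length := by
      rw [← Walk.length_map (Embedding.induce B).toHom, Walk.map_induce]
      rfl
    rcases hB B hblock with ⟨⟨e⟩⟩ | ⟨k, -, ⟨e⟩⟩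
    · rw [← cycleGraph_two_eq_top] at e
      have := ((Walk.isCycle_map_iff_of_injective (f := e.toHom) e.injective).2
        hwi).length_eq_of_cycleGraph
      have := hwi.three_le_length
      simp_all
    · have := ((Walk.isCycle_map_iff_of_injective (f := e.toHom) e.injective).2
        hwi).length_eq_of_cycleGraph
      rw [Walk.length_map, hlen] at this
      grind
end

section
/- A graph G on n vertices with m edges has an odd cycle factor if and only if its line graph L(G) has an even cycle transversal of size at most m − n. -/
/-- `G` has an odd cycle factor: a spanning subgraph each of whose connected
components is an odd cycle. -/
def HasOddCycleFactor {V : Type*} (G : SimpleGraph V) : Prop :=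
  ∃ H : SimpleGraph V, H ≤ G ∧ ∀ c : H.ConnectedComponent, ∃ k : ℕ, 1 ≤ k ∧
    Nonempty ((H.induce c.supp) ≃g SimpleGraph.cycleGraph (2 * k + 1))

/-- `S` is an even cycle transversal of `H`: it meets every even cycle. -/
def IsEvenCycleTransversal {W : Type*} (H : SimpleGraph W) (S : Set W) : Prop :=
  ∀ (v : W) (w : H.Walk v v), w.IsCycle → Even w.length → ∃ x ∈ S, x ∈ w.support

namespace SimpleGraph

variable {V W : Type*}

/-- A cyclic sequence of at least three distinct, consecutively adjacent vertices is a cycle. -/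
lemma exists_isCycle_of_injOn {K : SimpleGraph W} {L : ℕ} (hL : 3 ≤ L) (g : ℕ → W)
    (hinj : Set.InjOn g (Set.Iio L)) (hadj : ∀ i, i + 1 < L → K.Adj (g i) (g (i + 1)))
    (hlast : K.Adj (g (L - 1)) (g 0)) :
    ∃ (v : W) (p : K.Walk v v), p.IsCycle ∧ p.length = L := by
  rw [← cycleGraph_isContained_iff (by lia)]
  refine ⟨⟨⟨fun i ↦ g i, ?_⟩, fun i j h ↦ Fin.ext (hinj i.2 j.2 h)⟩⟩
  have key : ∀ i j : Fin L, (i - j).val = 1 → K.Adj (g j) (g i) := by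
    intro i j hij
    rcases le_or_gt j i with hle | hlt
    · rw [Fin.sub_val_of_le hle] at hij
      have : (i : ℕ) = j + 1 := by have := Fin.le_def.mp hle; lia
      rw [this]
      exact hadj _ (this ▸ i.2)
    · rw [Fin.coe_sub_iff_lt.mpr hlt] at hij
      rw [show (j : ℕ) = L - 1 by lia, show (i : ℕ) = 0 by lia]
      exact hlast
  intro i j hij
  rcases cycleGraph_adj'.mp hij with h | h
  exacts [(key i j h).symm, key j i h]

lemma Walk.IsCycle.getVert_eq_getVert {H : SimpleGraph V} {u : V} {p : H.Walk u u}
    (hp : p.IsCycle) {i j : ℕ} (hi : i ≤ p.length) (hj : j ≤ p.length)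
    (h : p.getVert i = p.getVert j) :
    i = j ∨ (i = 0 ∧ j = p.length) ∨ (i = p.length ∧ j = 0) := by
  rcases Nat.eq_zero_or_pos i with rfl | hi0
  · have := (hp.getVert_endpoint_iff hj).mp (by simpa using h.symm)
    lia
  rcases Nat.eq_zero_or_pos j with rfl | hj0
  · have := (hp.getVert_endpoint_iff hi).mp (by simpa using h)
    lia
  · exact Or.inl (hp.getVert_injOn ⟨hi0, hi⟩ ⟨hj0, hj⟩ h)

lemma Walk.IsCycle.edge_getVert_injOn {H : SimpleGraph V} {u : V} {p : H.Walk u u}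
    (hp : p.IsCycle) :
    Set.InjOn (fun i ↦ s(p.getVert i, p.getVert (i + 1))) (Set.Iio p.length) := by
  intro i hi j hj h
  have := hp.three_le_length
  simp only [Set.mem_Iio] at hi hj
  rcases Sym2.eq_iff.mp h with ⟨h1, -⟩ | ⟨h1, h2⟩
  · have := hp.getVert_eq_getVert (by lia) (by lia) h1
    lia
  · have := hp.getVert_eq_getVert (by lia) (by lia) h1
    have := hp.getVert_eq_getVert (by lia) (by lia) h2
    lia

/-- A cycle of `H` yields a cycle of the same length in the line graph. -/
lemma Walk.IsCycle.exists_isCycle_lineGraph {H : SimpleGraph V} {u : V} {p : H.Walk u u}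
    (hp : p.IsCycle) :
    ∃ (e : H.edgeSet) (q : H.lineGraph.Walk e e), q.IsCycle ∧ q.length = p.length := by
  have h3 := hp.three_le_length
  have hex : ∀ i, ∃ e : H.edgeSet, i < p.length → e.1 = s(p.getVert i, p.getVert (i + 1)) := by
    intro i
    by_cases hi : i < p.length
    · exact ⟨⟨_, p.adj_getVert_succ hi⟩, fun _ ↦ rfl⟩
    · exact ⟨⟨s(u, p.snd), p.adj_snd hp.not_nil⟩, fun h ↦ absurd h hi⟩
  choose g hg using hex
  have hinj : Set.InjOn g (Set.Iio p.length) := by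
    intro i hi j hj h
    apply hp.edge_getVert_injOn hi hj
    simp only [← hg i hi, ← hg j hj, h]
  refine exists_isCycle_of_injOn h3 g hinj (fun i hi ↦ ?_) ?_
  · rw [lineGraph_adj_iff_exists]
    refine ⟨fun h ↦ ?_, p.getVert (i + 1), ?_, ?_⟩
    · have := hinj (Set.mem_Iio.mpr (by lia)) (Set.mem_Iio.mpr hi) h
      lia
    · simp [hg i (by lia)]
    · simp [hg (i + 1) hi]
  · rw [lineGraph_adj_iff_exists]
    refine ⟨fun h ↦ ?_, u, ?_, ?_⟩
    · have := hinj (Set.mem_Iio.mpr (by lia)) (Set.mem_Iio.mpr (by lia)) h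
      lia
    · simp [hg (p.length - 1) (by lia), show p.length - 1 + 1 = p.length by lia]
    · simp [hg 0 (by lia)]

/-- A cycle of `H` through `u` and a further edge at `u` yield a longer cycle in the line graph. -/
lemma Walk.IsCycle.exists_isCycle_lineGraph_of_adj {H : SimpleGraph V} {u x : V} {p : H.Walk u u}
    (hp : p.IsCycle) (hx : H.Adj u x) (hxp : ¬ p.toSubgraph.Adj u x) :
    ∃ (e : H.edgeSet) (q : H.lineGraph.Walk e e), q.IsCycle ∧ q.length = p.length + 1 := by
  have h3 := hp.three_le_length
  have hex : ∀ i, ∃ e : H.edgeSet, (i < p.length → e.1 = s(p.getVert i, p.getVert (i + 1))) ∧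
      (p.length ≤ i → e.1 = s(u, x)) := by
    intro i
    by_cases hi : i < p.length
    · exact ⟨⟨_, p.adj_getVert_succ hi⟩, fun _ ↦ rfl, fun h ↦ by lia⟩
    · exact ⟨⟨s(u, x), hx⟩, fun h ↦ absurd h hi, fun _ ↦ rfl⟩
  choose g hg hgx using hex
  have hne : ∀ i < p.length, g i ≠ g p.length := by
    intro i hi h
    apply hxp
    have h' := congrArg Subtype.val h
    rw [hg i hi, hgx _ le_rfl] at h'
    rw [← Subgraph.mem_edgeSet, ← h', Subgraph.mem_edgeSet]
    exact p.toSubgraph_adj_getVert hi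
  have hinj : Set.InjOn g (Set.Iio (p.length + 1)) := by
    intro i hi j hj h
    simp only [Set.mem_Iio] at hi hj
    by_cases hi' : i < p.length <;> by_cases hj' : j < p.length
    · apply hp.edge_getVert_injOn hi' hj'
      simp only [← hg i hi', ← hg j hj', h]
    · obtain rfl : j = p.length := by lia
      exact absurd h (hne i hi')
    · obtain rfl : i = p.length := by lia
      exact absurd h.symm (hne j hj')
    · lia
  refine exists_isCycle_of_injOn (by lia) g hinj (fun i hi ↦ ?_) ?_
  · rw [lineGraph_adj_iff_exists]
    refine ⟨fun h ↦ ?_, p.getVert (i + 1), ?_, ?_⟩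
    · have := hinj (Set.mem_Iio.mpr (by lia)) (Set.mem_Iio.mpr hi) h
      lia
    · simp [hg i (by lia)]
    · by_cases hi' : i + 1 < p.length
      · simp [hg (i + 1) hi']
      · rw [hgx (i + 1) (by lia), show i + 1 = p.length by lia]
        simp
  · rw [lineGraph_adj_iff_exists]
    refine ⟨(hne 0 (by lia)).symm, u, ?_, ?_⟩
    · simp [hgx p.length le_rfl]
    · simp [hg 0 (by lia)]

lemma IsAcyclic.card_edgeFinset_lt [Fintype W] [Nonempty W] {K : SimpleGraph W}
    [Fintype K.edgeSet] (hK : K.IsAcyclic) : K.edgeFinset.card < Fintype.card W := by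
  classical
  obtain ⟨T, hKT, -, hT⟩ := connected_top.exists_isTree_le_of_le_of_isAcyclic le_top hK
  rw [← hT.card_edgeFinset, Nat.lt_succ_iff]
  exact Finset.card_le_card (edgeFinset_mono hKT)

lemma ncard_neighborSet_cycleGraph {L : ℕ} (hL : 3 ≤ L) (i : Fin L) :
    ((cycleGraph L).neighborSet i).ncard = 2 := by
  obtain ⟨n, rfl⟩ : ∃ n, L = n + 3 := ⟨L - 3, by lia⟩
  rw [← Nat.card_coe_set_eq, Nat.card_eq_fintype_card, card_neighborSet_eq_degree,
    cycleGraph_degree_three_le]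

/-- A connected finite graph all of whose vertices have two neighbours is a cycle graph, and
it has a spanning cycle. -/
lemma exists_iso_cycleGraph [Finite W] {K : SimpleGraph W} (hK : K.Connected)
    (h2 : ∀ v, (K.neighborSet v).ncard = 2) :
    ∃ (v : W) (p : K.Walk v v), p.IsCycle ∧ Nonempty (K ≃g cycleGraph p.length) := by
  classical
  have := Fintype.ofFinite W
  have hcyc : K.IsCycles := fun v _ ↦ h2 v
  obtain ⟨v⟩ := hK.nonempty
  obtain ⟨p, hp, hverts⟩ := hcyc.exists_cycle_toSubgraph_verts_eq_connectedComponentSupp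
    (c := K.connectedComponentMk v) rfl (Set.nonempty_of_ncard_ne_zero (by simp [h2 v]))
  have hcard : Fintype.card W = p.length := by
    have hmem : ∀ w, w ∈ p.support.tail := by
      intro w
      have hw : w ∈ p.support := by
        rw [← Walk.mem_verts_toSubgraph, hverts]
        exact ConnectedComponent.sound (hK.preconnected w v)
      rw [p.mem_support_iff] at hw
      rcases hw with rfl | hw
      · exact Walk.end_mem_tail_support hp.not_nil
      · exact hw
    have : p.support.tail.toFinset = Finset.univ := by ext; simp [hmem]
    rw [← Finset.card_univ, ← this, List.toFinset_card_of_nodup hp.support_nodup]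
    simp
  have h3 := hp.three_le_length
  obtain ⟨f⟩ := (cycleGraph_isContained_iff (by lia)).mpr ⟨v, p, hp, rfl⟩
  have hbij : Function.Bijective f :=
    (Fintype.bijective_iff_injective_and_card f).mpr ⟨f.injective, by simp [hcard]⟩
  refine ⟨v, p, hp, ⟨RelIso.symm ⟨Equiv.ofBijective f hbij, ?_⟩⟩⟩
  intro i j
  refine ⟨fun h ↦ ?_, fun h ↦ f.toHom.map_adj h⟩
  have himg : f '' (cycleGraph p.length).neighborSet i = K.neighborSet (f i) := by
    apply Set.eq_of_subset_of_ncard_le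
    · rintro _ ⟨k, hk, rfl⟩
      exact f.toHom.map_adj hk
    · have himage : (f '' (cycleGraph p.length).neighborSet i).ncard = 2 := by
        rw [Set.ncard_image_of_injective _ hbij.injective, ncard_neighborSet_cycleGraph h3]
      rw [himage, h2]
    · exact Set.toFinite _
  have : f j ∈ f '' (cycleGraph p.length).neighborSet i := by
    rw [himg]
    exact h
  obtain ⟨k, hk, hkj⟩ := this
  rwa [← f.injective hkj]

lemma ncard_neighborSet_induce_supp {H : SimpleGraph V} (c : H.ConnectedComponent) (v : c.supp) :
    ((H.induce c.supp).neighborSet v).ncard = (H.neighborSet v).ncard := by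
  rw [← Set.ncard_image_of_injective _ Subtype.val_injective]
  congr 1
  ext w
  constructor
  · rintro ⟨x, hx, rfl⟩
    exact hx
  · intro hw
    exact ⟨⟨w, c.mem_supp_of_adj_mem_supp v.2 hw⟩, hw, rfl⟩

lemma degree_eq_ncard_neighborSet (H : SimpleGraph V) (v : V) [Fintype (H.neighborSet v)] :
    H.degree v = (H.neighborSet v).ncard := by
  rw [← card_neighborSet_eq_degree, ← Nat.card_eq_fintype_card, Nat.card_coe_set_eq]

section OddLineGraph

variable {H : SimpleGraph V}

lemma Walk.IsCycle.adj_toSubgraph_of_odd_lineGraph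
    (hodd : ∀ (e : H.edgeSet) (q : H.lineGraph.Walk e e), q.IsCycle → Odd q.length)
    {u x : V} {p : H.Walk u u} (hp : p.IsCycle) (hx : H.Adj u x) : p.toSubgraph.Adj u x := by
  by_contra hxp
  obtain ⟨e, q, hq, hql⟩ := hp.exists_isCycle_lineGraph
  obtain ⟨e', q', hq', hql'⟩ := hp.exists_isCycle_lineGraph_of_adj hx hxp
  have h := hodd e q hq
  have h' := hodd e' q' hq'
  rw [hql] at h
  rw [hql'] at h'
  grind

/-- If all cycles of the line graph are odd and there are at least as many edges as vertices,
then every vertex has exactly two neighbours. -/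
lemma ncard_neighborSet_eq_two_of_odd_lineGraph [Fintype V]
    (hodd : ∀ (e : H.edgeSet) (q : H.lineGraph.Walk e e), q.IsCycle → Odd q.length)
    (hcard : Fintype.card V ≤ H.edgeSet.ncard) (v : V) : (H.neighborSet v).ncard = 2 := by
  classical
  set C : Set V := {v | ∃ p : H.Walk v v, p.IsCycle}
  have hdeg : ∀ v ∈ C, (H.neighborSet v).ncard = 2 := by
    rintro v ⟨p, hp⟩
    rw [← hp.ncard_neighborSet_toSubgraph_eq_two p.start_mem_support]
    congr 1
    ext x
    exact ⟨fun hx ↦ hp.adj_toSubgraph_of_odd_lineGraph hodd hx, fun hx ↦ hx.adj_sub⟩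
  have hclosed : ∀ u v, H.Adj u v → u ∈ C → v ∈ C := by
    rintro u v huv ⟨p, hp⟩
    have hv := (hp.adj_toSubgraph_of_odd_lineGraph hodd huv).snd_mem
    rw [Walk.mem_verts_toSubgraph] at hv
    exact ⟨p.rotate v hv, hp.rotate hv⟩
  suffices h : IsEmpty (Cᶜ : Set V) from hdeg v (by_contra fun hv ↦ h.false ⟨v, hv⟩)
  by_contra hne
  rw [not_isEmpty_iff] at hne
  have hacyc : (H.induce Cᶜ).IsAcyclic := by
    intro v p hp
    exact v.2 ⟨p.map (Embedding.induce Cᶜ).toHom, hp.map Subtype.val_injective⟩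
  have hlt := hacyc.card_edgeFinset_lt
  have hsum := H.sum_degrees_eq_twice_card_edges
  have hsum' := (H.induce Cᶜ).sum_degrees_eq_twice_card_edges
  have hdeg' : ∀ v : (Cᶜ : Set V), (H.induce Cᶜ).degree v = H.degree v := by
    intro v
    rw [degree_eq_ncard_neighborSet, degree_eq_ncard_neighborSet,
      ← Set.ncard_image_of_injective _ Subtype.val_injective]
    congr 1
    ext w
    constructor
    · rintro ⟨x, hx, rfl⟩
      exact hx
    · intro hw
      exact ⟨⟨w, fun hwC ↦ v.2 (hclosed w v hw.symm hwC)⟩, hw, rfl⟩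
  have hsplit := Fintype.sum_subtype_add_sum_subtype (fun v ↦ v ∈ Cᶜ) (fun v ↦ H.degree v)
  have h2 : ∑ v : {v // ¬ v ∈ Cᶜ}, H.degree v = Fintype.card {v // ¬ v ∈ Cᶜ} * 2 := by
    rw [Finset.sum_const_nat (m := 2), Finset.card_univ]
    intro v _
    rw [degree_eq_ncard_neighborSet, hdeg v (by simpa using v.2)]
  have hcompl := Fintype.card_subtype_compl (fun v ↦ v ∈ Cᶜ)
  have hle := Fintype.card_subtype_le (fun v ↦ v ∈ Cᶜ)
  simp only [hdeg'] at hsum'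
  have hA : ∑ v : {v // v ∈ Cᶜ}, H.degree v = 2 * (H.induce Cᶜ).edgeFinset.card := by
    convert hsum'
  have hB : (H.induce Cᶜ).edgeFinset.card < Fintype.card {v // v ∈ Cᶜ} := by
    convert hlt
  rw [Set.ncard_eq_toFinset_card', ← edgeFinset] at hcard
  lia

end OddLineGraph

section TwoRegular

variable {H : SimpleGraph V}

lemma ncard_edgeSet_of_ncard_neighborSet_eq_two [Fintype V]
    (h2 : ∀ v, (H.neighborSet v).ncard = 2) : H.edgeSet.ncard = Fintype.card V := by
  classical
  have hsum := H.sum_degrees_eq_twice_card_edges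
  simp only [degree_eq_ncard_neighborSet, h2, Finset.sum_const, Finset.card_univ] at hsum
  rw [Set.ncard_eq_toFinset_card', ← edgeFinset]
  lia

lemma ncard_incidenceSet_of_ncard_neighborSet_eq_two
    (h2 : ∀ v, (H.neighborSet v).ncard = 2) (v : V) : (H.incidenceSet v).ncard = 2 := by
  classical
  rw [← h2 v]
  exact Nat.card_congr (H.incidenceSetEquivNeighborSet v)

lemma reachable_of_mem_support_lineGraph {x y : H.edgeSet} (w : H.lineGraph.Walk x y) :
    ∀ e ∈ w.support, ∀ u ∈ x.1, ∀ v ∈ e.1, H.Reachable u v := by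
  have hedge : ∀ e : H.edgeSet, ∀ u ∈ e.1, ∀ v ∈ e.1, H.Reachable u v := by
    rintro ⟨⟨a, b⟩, hab⟩ u hu v hv
    have hab : H.Adj a b := hab
    rcases Sym2.mem_iff.mp hu with rfl | rfl <;> rcases Sym2.mem_iff.mp hv with rfl | rfl
    exacts [.refl _, hab.reachable, hab.symm.reachable, .refl _]
  induction w with
  | nil =>
    intro e he
    rw [Walk.support_nil, List.mem_singleton] at he
    subst he
    exact hedge e
  | cons h p ih =>
    intro e he u hu v hv
    rw [Walk.support_cons, List.mem_cons] at he
    rcases he with rfl | he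
    · exact hedge e u hu v hv
    · obtain ⟨-, z, hz, hz'⟩ := lineGraph_adj_iff_exists.mp h
      exact (hedge _ u hu z hz).trans (ih e he z hz' v hv)

/-- In a graph all of whose vertices have two neighbours, a cycle of the line graph is closed under
incidence. -/
lemma Walk.IsCycle.mem_support_lineGraph (h2 : ∀ v, (H.neighborSet v).ncard = 2)
    {x : H.edgeSet} {w : H.lineGraph.Walk x x} (hw : w.IsCycle) {e e' : H.edgeSet}
    (he : e ∈ w.support) {v : V} (hv : v ∈ e.1) (hv' : v ∈ e'.1) : e' ∈ w.support := by
  classical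
  by_cases hee : e' = e
  · rwa [hee]
  have hother : ∀ u ∈ e.1, (H.incidenceSet u \ {e.1}).ncard = 1 := by
    intro u hu
    have hmem : e.1 ∈ H.incidenceSet u := ⟨e.2, hu⟩
    rw [Set.ncard_sdiff_singleton_of_mem hmem,
      ncard_incidenceSet_of_ncard_neighborSet_eq_two h2]
  obtain ⟨a, b, hab⟩ : ∃ a b, e.1 = s(a, b) := by
    obtain ⟨⟨a, b⟩, h⟩ := e
    exact ⟨a, b, rfl⟩
  obtain ⟨f, hf⟩ := Set.ncard_eq_one.mp (hother a (by simp [hab]))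
  obtain ⟨g, hg⟩ := Set.ncard_eq_one.mp (hother b (by simp [hab]))
  have hsub : ∀ d : H.edgeSet, d ≠ e → ∀ u ∈ e.1, u ∈ d.1 → d.1 ∈ ({f, g} : Set (Sym2 V)) := by
    intro d hd u hu hud
    have hmem : d.1 ∈ H.incidenceSet u \ {e.1} := ⟨⟨d.2, hud⟩, fun h ↦ hd (Subtype.ext h)⟩
    rw [hab, Sym2.mem_iff] at hu
    rcases hu with rfl | rfl
    · rw [hf] at hmem
      exact Or.inl hmem
    · rw [hg] at hmem
      exact Or.inr hmem
  have heq : Subtype.val '' w.toSubgraph.neighborSet e = ({f, g} : Set (Sym2 V)) := by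
    apply Set.eq_of_subset_of_ncard_le
    · rintro _ ⟨d, hd, rfl⟩
      obtain ⟨hne, u, hu, hud⟩ := lineGraph_adj_iff_exists.mp hd.adj_sub
      exact hsub d hne.symm u hu hud
    · rw [Set.ncard_image_of_injective _ Subtype.val_injective,
        hw.ncard_neighborSet_toSubgraph_eq_two he]
      exact (Set.ncard_insert_le f {g}).trans (by rw [Set.ncard_singleton])
    · exact Set.toFinite _
  obtain ⟨d, hd, hde⟩ := heq ▸ hsub e' hee v hv hv'
  rw [← Subtype.ext hde, ← Walk.mem_verts_toSubgraph]
  exact hd.snd_mem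

/-- In a graph all of whose vertices have two neighbours, a cycle of the line graph has as many
vertices as some component of the graph. -/
lemma Walk.IsCycle.exists_ncard_supp_eq_length_lineGraph [Finite V]
    (h2 : ∀ v, (H.neighborSet v).ncard = 2)
    {x : H.edgeSet} {w : H.lineGraph.Walk x x} (hw : w.IsCycle) :
    ∃ c : H.ConnectedComponent, c.supp.ncard = w.length := by
  classical
  have := Fintype.ofFinite V
  obtain ⟨a, ha⟩ : ∃ a, a ∈ x.1 := ⟨_, x.1.out_fst_mem⟩
  have hinc : ∀ v, H.Reachable a v → ∀ e : H.edgeSet, v ∈ e.1 → e ∈ w.support := by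
    rintro v ⟨p⟩
    suffices h : ∃ e ∈ w.support, v ∈ e.1 by
      obtain ⟨e, he, hve⟩ := h
      exact fun e' he' ↦ hw.mem_support_lineGraph h2 he hve he'
    induction p using Walk.concatRec with
    | Hnil => exact ⟨x, w.start_mem_support, ha⟩
    | Hconcat p h ih =>
      obtain ⟨e, he, hve⟩ := ih ha
      exact ⟨⟨_, h⟩, hw.mem_support_lineGraph h2 he hve (Sym2.mem_mk_left _ _),
        Sym2.mem_mk_right _ _⟩
  refine ⟨H.connectedComponentMk a, ?_⟩
  have hmem : ∀ e : H.edgeSet, e ∈ w.support.tail ↔ e ∈ w.support := by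
    intro e
    rw [w.mem_support_iff]
    refine ⟨Or.inr, ?_⟩
    rintro (rfl | h)
    exacts [Walk.end_mem_tail_support hw.not_nil, h]
  have hT : w.support.tail.toFinset.card = w.length := by
    rw [List.toFinset_card_of_nodup hw.support_nodup]
    simp
  rw [← hT, Set.ncard_eq_toFinset_card']
  have hreach : ∀ v, v ∈ (H.connectedComponentMk a).supp ↔ H.Reachable a v := by
    intro v
    rw [ConnectedComponent.mem_supp_iff, ConnectedComponent.eq, reachable_comm]
  refine Nat.eq_of_mul_eq_mul_right two_pos
    (Finset.card_mul_eq_card_mul (fun v (e : H.edgeSet) ↦ v ∈ e.1) ?_ ?_)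
  · intro v hv
    rw [Set.mem_toFinset, hreach] at hv
    rw [← ncard_incidenceSet_of_ncard_neighborSet_eq_two h2 v, ← Set.ncard_coe_finset,
      ← Set.ncard_image_of_injective _ Subtype.val_injective]
    congr 1
    ext e
    constructor
    · rintro ⟨d, hd, rfl⟩
      rw [Finset.mem_coe, Finset.mem_bipartiteAbove] at hd
      exact ⟨d.2, hd.2⟩
    · rintro ⟨he, hve⟩
      refine ⟨⟨e, he⟩, ?_, rfl⟩
      rw [Finset.mem_coe, Finset.mem_bipartiteAbove, List.mem_toFinset, hmem]
      exact ⟨hinc v hv _ hve, hve⟩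
  · intro e he
    rw [List.mem_toFinset, hmem] at he
    rw [← Sym2.card_toFinset_of_not_isDiag e.1 (H.not_isDiag_of_mem_edgeSet e.2)]
    congr 1
    ext v
    rw [Finset.mem_bipartiteBelow, Sym2.mem_toFinset, Set.mem_toFinset, hreach]
    exact ⟨And.right, fun hv ↦ ⟨reachable_of_mem_support_lineGraph w e he a ha v hv, hv⟩⟩

end TwoRegular

lemma Iso.ncard_neighborSet_eq {G : SimpleGraph V} {K : SimpleGraph W} (f : G ≃g K) (v : V) :
    (G.neighborSet v).ncard = (K.neighborSet (f v)).ncard :=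
  Nat.card_congr (f.mapNeighborSet v)

section Transversal

variable {G H : SimpleGraph V}

lemma isEvenCycleTransversal_lineGraph_of_odd
    (hodd : ∀ (e : H.edgeSet) (q : H.lineGraph.Walk e e), q.IsCycle → Odd q.length) :
    IsEvenCycleTransversal G.lineGraph {e | e.1 ∉ H.edgeSet} := by
  intro v w hw heven
  by_contra! hS
  have hsupp : ∀ x ∈ w.support, x ∈ {e : G.edgeSet | e.1 ∈ H.edgeSet} :=
    fun x hx ↦ by_contra fun hxH ↦ hS x hxH hx
  let f : G.lineGraph.induce {e : G.edgeSet | e.1 ∈ H.edgeSet} →g H.lineGraph :=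
    ⟨fun e ↦ ⟨e.1.1, e.2⟩, fun {e e'} h ↦ by
      obtain ⟨hne, z, hz, hz'⟩ := lineGraph_adj_iff_exists.mp (induce_adj.mp h)
      exact lineGraph_adj_iff_exists.mpr
        ⟨fun h' ↦ hne (Subtype.ext (Subtype.mk.inj h')), z, hz, hz'⟩⟩
  have hf : Function.Injective f := fun e e' h ↦
    Subtype.ext (Subtype.ext (Subtype.mk.inj h))
  have hcyc : (w.induce _ hsupp).IsCycle := by
    apply Walk.IsCycle.of_map (f := (Embedding.induce _).toHom)
    rwa [Walk.map_induce]
  have h := hodd _ _ (hcyc.map hf)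
  rw [Walk.length_map, ← Walk.length_map (Embedding.induce _).toHom, Walk.map_induce] at h
  exact Nat.not_odd_iff_even.mpr heven h

lemma odd_lineGraph_of_isEvenCycleTransversal {S : Set G.edgeSet}
    (hS : IsEvenCycleTransversal G.lineGraph S)
    (hle : H ≤ G) (hHS : ∀ e ∈ S, e.1 ∉ H.edgeSet) (e : H.edgeSet) (q : H.lineGraph.Walk e e)
    (hq : q.IsCycle) : Odd q.length := by
  let f : H.lineGraph →g G.lineGraph :=
    ⟨fun e ↦ ⟨e.1, edgeSet_mono hle e.2⟩, fun {e e'} h ↦ by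
      obtain ⟨hne, z, hz, hz'⟩ := lineGraph_adj_iff_exists.mp h
      exact lineGraph_adj_iff_exists.mpr
        ⟨fun h' ↦ hne (Subtype.ext (Subtype.mk.inj h')), z, hz, hz'⟩⟩
  have hf : Function.Injective f := fun e e' h ↦ Subtype.ext (Subtype.mk.inj h)
  by_contra heven
  rw [Nat.not_odd_iff_even, ← Walk.length_map f] at heven
  obtain ⟨x, hxS, hx⟩ := hS _ _ (hq.map hf) heven
  rw [Walk.support_map, List.mem_map] at hx
  obtain ⟨d, -, rfl⟩ := hx
  exact hHS _ hxS d.2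

end Transversal

/-- If all cycles of the line graph of `H` are odd and there are at least as many edges as vertices,
then every component of `H` is an odd cycle. -/
lemma exists_iso_odd_cycleGraph_of_odd_lineGraph [Fintype V] {H : SimpleGraph V}
    (hodd : ∀ (e : H.edgeSet) (q : H.lineGraph.Walk e e), q.IsCycle → Odd q.length)
    (hcard : Fintype.card V ≤ H.edgeSet.ncard) (c : H.ConnectedComponent) :
    ∃ k : ℕ, 1 ≤ k ∧ Nonempty ((H.induce c.supp) ≃g cycleGraph (2 * k + 1)) := by
  have h2 := ncard_neighborSet_eq_two_of_odd_lineGraph hodd hcard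
  obtain ⟨v, p, hp, hiso⟩ := exists_iso_cycleGraph (K := H.induce c.supp)
    c.connected_toSimpleGraph (fun v ↦ by rw [ncard_neighborSet_induce_supp, h2])
  obtain ⟨e, q, hq, hql⟩ :=
    (hp.map (f := (Embedding.induce c.supp).toHom) Subtype.val_injective).exists_isCycle_lineGraph
  have h := hodd e q hq
  rw [hql, Walk.length_map] at h
  obtain ⟨k, hk⟩ := h
  have h3 := hp.three_le_length
  exact ⟨k, by lia, hk ▸ hiso⟩

end SimpleGraph

open SimpleGraph

/-- A graph on `n` vertices with `m` edges has an odd cycle factor iff its line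
graph has an even cycle transversal of size at most `m - n`. -/
theorem oddCycleFactor_iff_lineGraph_ect {V : Type*} [Fintype V] [DecidableEq V]
    (G : SimpleGraph V) [DecidableRel G.Adj] (n m : ℕ)
    (hn : Fintype.card V = n) (hm : G.edgeFinset.card = m) :
    HasOddCycleFactor G ↔
      ∃ S : Set G.edgeSet, IsEvenCycleTransversal G.lineGraph S ∧
        (S.ncard : ℤ) ≤ (m : ℤ) - (n : ℤ) := by
  have hm' : G.edgeSet.ncard = m := by rw [Set.ncard_eq_toFinset_card', ← edgeFinset, hm]
  constructor
  · rintro ⟨H, hle, hcomp⟩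
    have h2 : ∀ v, (H.neighborSet v).ncard = 2 := by
      intro v
      obtain ⟨k, hk, ⟨f⟩⟩ := hcomp (H.connectedComponentMk v)
      rw [← ncard_neighborSet_induce_supp (H.connectedComponentMk v) ⟨v, rfl⟩,
        f.ncard_neighborSet_eq, ncard_neighborSet_cycleGraph (by lia)]
    refine ⟨{e | e.1 ∉ H.edgeSet}, isEvenCycleTransversal_lineGraph_of_odd fun e q hq ↦ ?_, ?_⟩
    · obtain ⟨c, hc⟩ := hq.exists_ncard_supp_eq_length_lineGraph h2
      obtain ⟨k, -, ⟨f⟩⟩ := hcomp c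
      refine ⟨k, ?_⟩
      rw [← hc, ← Nat.card_coe_set_eq, Nat.card_congr f.toEquiv, Nat.card_fin]
    · have hS : Subtype.val '' {e : G.edgeSet | e.1 ∉ H.edgeSet} = G.edgeSet \ H.edgeSet := by
        ext e
        simp [and_comm]
      have hadd := Set.ncard_sdiff_add_ncard_of_subset (edgeSet_mono hle)
      rw [← hS, Set.ncard_image_of_injective _ Subtype.val_injective, hm',
        ncard_edgeSet_of_ncard_neighborSet_eq_two h2, hn] at hadd
      lia
  · rintro ⟨S, hS, hcard⟩
    refine ⟨G.deleteEdges (Subtype.val '' S), deleteEdges_le _,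
      exists_iso_odd_cycleGraph_of_odd_lineGraph
        (odd_lineGraph_of_isEvenCycleTransversal hS (deleteEdges_le _) fun e he h ↦ ?_) ?_⟩
    · rw [edgeSet_deleteEdges] at h
      exact h.2 ⟨e, he, rfl⟩
    · have hsub : Subtype.val '' S ⊆ G.edgeSet := by
        rintro _ ⟨e, -, rfl⟩
        exact e.2
      have hadd := Set.ncard_sdiff_add_ncard_of_subset hsub
      rw [Set.ncard_image_of_injective _ Subtype.val_injective, hm'] at hadd
      rw [edgeSet_deleteEdges, hn]
      lia
end
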